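/- Let n ≥ 1 and let x be an invertible totally nonnegative n×n real matrix. Let w₀ denote the n×n antidiagonal permutation matrix, whose (i, n+1−i) entries equal 1 and all other entries equal 0. Then x is totally positive if and only if x lies in the intersection of the two opposite open Bruhat cells B w₀ B ∩ B₋ w₀ B₋; that is, if and only if there exist invertible upper-triangular real matrices b₁, b₂ and invertible lower-triangular real matrices c₁, c₂ such that x = b₁ w₀ b₂ and x = c₁ w₀ c₂. -/

import Mathlib

/-- A square real matrix is totally nonnegative if every minor (determinant of a
square submatrix selected by strictly increasing row and column indices) is nonnegative. -/
def TotallyNonneg {n : ℕ} (x : Matrix (Fin n) (Fin n) ℝ) : Prop :=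
  ∀ (k : ℕ) (f g : Fin k → Fin n), StrictMono f → StrictMono g →
    0 ≤ (x.submatrix f g).det

/-- A square real matrix is totally positive if every minor is positive. -/
def TotallyPos {n : ℕ} (x : Matrix (Fin n) (Fin n) ℝ) : Prop :=
  ∀ (k : ℕ) (f g : Fin k → Fin n), StrictMono f → StrictMono g →
    0 < (x.submatrix f g).det

/-- The antidiagonal permutation matrix `w₀`, with entries 1 at positions `(i, n+1-i)`
(in 1-indexed terms, i.e. `i + j = n - 1` in 0-indexed terms) and 0 elsewhere. -/
def antidiagPerm (n : ℕ) : Matrix (Fin n) (Fin n) ℝ :=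
  Matrix.of fun i j => if (i : ℕ) + (j : ℕ) = n - 1 then 1 else 0

open Matrix

/-- The vector of alternating maximal minors of an `m × (m + 1)` matrix. -/
def altMinors {m : ℕ} (B : Matrix (Fin m) (Fin (m + 1)) ℝ) (b : Fin (m + 1)) : ℝ :=
  (-1) ^ (b : ℕ) * (B.submatrix id b.succAbove).det

theorem row_zero_dotProduct_altMinors {m : ℕ} (A : Matrix (Fin (m + 1)) (Fin (m + 1)) ℝ) :
    A 0 ⬝ᵥ altMinors (A.submatrix Fin.succ id) = A.det := by
  rw [det_succ_row_zero, dotProduct]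
  refine Finset.sum_congr rfl fun b _ => ?_
  simp only [altMinors, submatrix_submatrix, Function.comp_id, Function.id_comp]
  ring

theorem mulVec_altMinors {m : ℕ} (B : Matrix (Fin m) (Fin (m + 1)) ℝ) :
    B *ᵥ altMinors B = 0 := by
  ext i
  have h := row_zero_dotProduct_altMinors (B.submatrix (Fin.cons i id : Fin (m + 1) → Fin m) id)
  rw [det_zero_of_row_eq (i := 0) (j := i.succ) (Fin.succ_ne_zero i).symm (by ext; simp)] at h
  exact h

/-- The kernel of a matrix with nonsingular last columns is spanned by `altMinors`. -/
theorem altMinors_zero_smul_of_mulVec_eq_zero {m : ℕ} (B : Matrix (Fin m) (Fin (m + 1)) ℝ)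
    (hB : altMinors B 0 ≠ 0) (v : Fin (m + 1) → ℝ) (hv : B *ᵥ v = 0) :
    altMinors B 0 • v = v 0 • altMinors B := by
  rw [← sub_eq_zero]
  set w := altMinors B 0 • v - v 0 • altMinors B with hw
  have hBw : B *ᵥ w = 0 := by
    rw [hw, mulVec_sub, mulVec_smul, mulVec_smul, hv, mulVec_altMinors]; simp
  have hw0 : w 0 = 0 := by simp [hw]; ring
  have hs : (B.submatrix id Fin.succ) *ᵥ (fun b => w b.succ) = 0 := by
    ext i
    have := congrFun hBw i
    simpa [mulVec, dotProduct, Fin.sum_univ_succ, hw0] using this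
  have hd : (B.submatrix id Fin.succ).det ≠ 0 := by
    intro h
    apply hB
    simp [altMinors, h]
  have := eq_zero_of_mulVec_eq_zero hd hs
  ext b
  refine Fin.cases hw0 (fun b => congrFun this b) b

/-- If an interior maximal minor of an `(m + 1) × (m + 2)` matrix vanishes, so does the minor
that omits the first column. -/
theorem det_succ_eq_zero_of_interior {m : ℕ} (A : Matrix (Fin (m + 1)) (Fin (m + 2)) ℝ)
    (p : Fin (m + 2)) (hp0 : p ≠ 0) (hpl : p ≠ Fin.last _)
    (hsmall : ∀ q : Fin (m + 1), 0 < (A.submatrix Fin.succ (p.succAbove ∘ q.succAbove)).det)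
    (hA : ∀ q : Fin (m + 2), 0 ≤ (A.submatrix id q.succAbove).det)
    (hp : (A.submatrix id p.succAbove).det = 0) :
    (A.submatrix id (Fin.succAbove 0)).det = 0 := by
  set B := A.submatrix Fin.succ p.succAbove with hB
  have hk : B *ᵥ (fun b => altMinors A (p.succAbove b)) = 0 := by
    ext i
    have := congrFun (mulVec_altMinors A) i.succ
    rw [mulVec, dotProduct, Fin.sum_univ_succAbove _ p] at this
    simpa [altMinors, hp, mulVec, dotProduct, hB] using this
  have h0 := hsmall 0
  have hl := hsmall (Fin.last m)
  have hB0 : altMinors B 0 = (A.submatrix Fin.succ (p.succAbove ∘ Fin.succAbove 0)).det := by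
    simp [altMinors, hB, submatrix_submatrix]
  have hBl : altMinors B (Fin.last m)
      = (-1) ^ m * (A.submatrix Fin.succ (p.succAbove ∘ (Fin.last m).succAbove)).det := by
    simp [altMinors, hB, submatrix_submatrix]
  have := congrFun (altMinors_zero_smul_of_mulVec_eq_zero B (by rw [hB0]; exact h0.ne') _ hk)
    (Fin.last m)
  simp only [Pi.smul_apply, smul_eq_mul, hB0, hBl, Fin.succAbove_ne_zero_zero hp0,
    Fin.succAbove_ne_last_last hpl] at this
  have hA0 := hA 0
  have hAl := hA (Fin.last _)
  simp only [altMinors, Fin.val_zero, Fin.val_last, pow_zero, one_mul, pow_succ] at this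
  generalize (A.submatrix id (Fin.succAbove 0)).det = D0 at *
  generalize (A.submatrix id (Fin.last _).succAbove).det = Dl at *
  generalize (A.submatrix Fin.succ (p.succAbove ∘ Fin.succAbove 0)).det = m0 at *
  generalize (A.submatrix Fin.succ (p.succAbove ∘ (Fin.last m).succAbove)).det = ml at *
  have h1 : (-1 : ℝ) ^ m ≠ 0 := by simp
  have h2 : D0 * ml = - (Dl * m0) := by
    apply mul_left_cancel₀ h1
    linarith
  have h3 : 0 ≤ Dl * m0 := by positivity
  have h4 : 0 ≤ D0 * ml := by positivity
  have h5 : D0 * ml = 0 := by linarith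
  rcases mul_eq_zero.1 h5 with h | h
  · exact h
  · linarith

/-- In a matrix with nonnegative determinant and corner minors, positive smaller minors,
and vanishing lower right corner minor, one of the other two corner minors vanishes. -/
theorem det_castSucc_succ_eq_zero {m : ℕ} (M : Matrix (Fin (m + 2)) (Fin (m + 2)) ℝ)
    (hM : 0 ≤ M.det)
    (hsmall : ∀ q : Fin (m + 1),
      0 < (M.submatrix (Fin.succ ∘ Fin.castSucc) (Fin.succ ∘ q.succAbove)).det)
    (hSE : (M.submatrix Fin.succ Fin.succ).det = 0)
    (hNE : 0 ≤ (M.submatrix Fin.castSucc Fin.succ).det)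
    (hSW : 0 < (M.submatrix Fin.succ Fin.castSucc).det) :
    (M.submatrix Fin.castSucc Fin.succ).det = 0 := by
  set R := M.submatrix Fin.succ id with hR
  set B := M.submatrix (Fin.succ ∘ Fin.castSucc) Fin.succ with hB
  set v : Fin (m + 1) → ℝ := fun b => altMinors R b.succ with hv
  have hR0 : altMinors R 0 = 0 := by
    simpa [altMinors, hR, submatrix_submatrix, Function.comp_def] using hSE
  have hk : B *ᵥ v = 0 := by
    ext i
    have := congrFun (mulVec_altMinors R) i.castSucc
    rw [mulVec, dotProduct, Fin.sum_univ_succ, hR0] at this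
    simpa [mulVec, dotProduct, hB, hR] using this
  have hdet : (fun b : Fin (m + 1) => M 0 b.succ) ⬝ᵥ v = M.det := by
    rw [← row_zero_dotProduct_altMinors M, ← hR, dotProduct, dotProduct,
      Fin.sum_univ_succ (fun b : Fin (m + 2) => M 0 b * altMinors R b), hR0]
    simp [hv]
  have hne : (fun b : Fin (m + 1) => M 0 b.succ) ⬝ᵥ altMinors B
      = (M.submatrix Fin.castSucc Fin.succ).det :=
    row_zero_dotProduct_altMinors (M.submatrix Fin.castSucc Fin.succ)
  have h0 := hsmall 0
  have hl := hsmall (Fin.last m)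
  have hB0 : altMinors B 0
      = (M.submatrix (Fin.succ ∘ Fin.castSucc) (Fin.succ ∘ Fin.succAbove 0)).det := by
    simp [altMinors, hB, submatrix_submatrix]
  have hBl : altMinors B (Fin.last m) = (-1) ^ m *
      (M.submatrix (Fin.succ ∘ Fin.castSucc) (Fin.succ ∘ (Fin.last m).succAbove)).det := by
    simp [altMinors, hB, submatrix_submatrix]
  have hvl : v (Fin.last m) = - ((-1) ^ m * (M.submatrix Fin.succ Fin.castSucc).det) := by
    simp only [hv, altMinors, hR, submatrix_submatrix, Fin.succ_last, Fin.succAbove_last,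
      Function.comp_id, Function.id_comp, Fin.val_last, pow_succ]
    simp
  have key := altMinors_zero_smul_of_mulVec_eq_zero B (by rw [hB0]; exact h0.ne') v hk
  have k1 := congrFun key (Fin.last m)
  have k2 := congrArg (fun u => (fun b : Fin (m + 1) => M 0 b.succ) ⬝ᵥ u) key
  simp only [dotProduct_smul, hdet, hne, smul_eq_mul, hB0] at k2
  simp only [Pi.smul_apply, smul_eq_mul, hB0, hBl, hvl] at k1
  generalize (M.submatrix (Fin.succ ∘ Fin.castSucc) (Fin.succ ∘ Fin.succAbove 0)).det = m0 at *
  generalize (M.submatrix (Fin.succ ∘ Fin.castSucc)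
    (Fin.succ ∘ (Fin.last m).succAbove)).det = ml at *
  generalize (M.submatrix Fin.castSucc Fin.succ).det = NE at *
  generalize (M.submatrix Fin.succ Fin.castSucc).det = SW at *
  have h1 : (-1 : ℝ) ^ m ≠ 0 := by simp
  have h2 : v 0 * ml = - (SW * m0) := by
    apply mul_left_cancel₀ h1
    linarith
  have h3 : 0 < SW * m0 := by positivity
  have h4 : v 0 < 0 := by
    by_contra h
    push Not at h
    have : 0 ≤ v 0 * ml := by positivity
    linarith
  have h5 : 0 ≤ m0 * M.det := by positivity
  nlinarith

/-- Schur complement with respect to the upper left entry. -/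
noncomputable def schurStep (X : Matrix ℕ ℕ ℝ) : Matrix ℕ ℕ ℝ :=
  Matrix.of fun i j => X (i + 1) (j + 1) - X (i + 1) 0 / X 0 0 * X 0 (j + 1)

theorem det_submatrix_cons_zero (X : Matrix ℕ ℕ ℝ) (hX : X 0 0 ≠ 0) {k : ℕ} (f g : Fin k → ℕ) :
    (X.submatrix (Fin.cons 0 (fun a => f a + 1) : Fin (k + 1) → ℕ)
      (Fin.cons 0 (fun a => g a + 1) : Fin (k + 1) → ℕ)).det
      = X 0 0 * ((schurStep X).submatrix f g).det := by
  set f' : Fin (k + 1) → ℕ := Fin.cons 0 (fun a => f a + 1) with hf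
  set g' : Fin (k + 1) → ℕ := Fin.cons 0 (fun a => g a + 1) with hg
  set c : Fin (k + 1) → ℝ := Fin.cons 0 (fun a => X (f a + 1) 0 / X 0 0) with hc
  rw [det_eq_of_forall_row_eq_smul_add_const (B := Matrix.of fun i j =>
    X (f' i) (g' j) - c i * X 0 (g' j)) c 0 (by simp [hc]) (by intro i j; simp [hc, hf]),
    det_succ_column_zero, Fin.sum_univ_succ]
  have : ∀ i : Fin k, X (f i + 1) 0 - X (f i + 1) 0 / X 0 0 * X 0 0 = 0 := by
    intro i; field_simp; simp
  simp [hc, hf, hg, this]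
  left
  congr 1

/-- All minors of the upper left `n × n` block of `X` are nonnegative. -/
def MinorsNonneg (X : Matrix ℕ ℕ ℝ) (n : ℕ) : Prop :=
  ∀ (k : ℕ) (f g : Fin k → ℕ), StrictMono f → StrictMono g → (∀ a, f a < n) → (∀ a, g a < n) →
    0 ≤ (X.submatrix f g).det

/-- All minors of order `k` of the upper left `n × n` block of `X` are positive. -/
def MinorsPos (X : Matrix ℕ ℕ ℝ) (n k : ℕ) : Prop :=
  ∀ f g : Fin k → ℕ, StrictMono f → StrictMono g → (∀ a, f a < n) → (∀ a, g a < n) →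
    0 < (X.submatrix f g).det

theorem MinorsNonneg.mono {X : Matrix ℕ ℕ ℝ} {n k : ℕ} (hX : MinorsNonneg X n) (hk : k ≤ n) :
    MinorsNonneg X k := fun l f g hf hg hfn hgn =>
  hX l f g hf hg (fun a => (hfn a).trans_le hk) (fun a => (hgn a).trans_le hk)

theorem MinorsNonneg.transpose {X : Matrix ℕ ℕ ℝ} {n : ℕ} (hX : MinorsNonneg X n) :
    MinorsNonneg Xᵀ n := fun l f g hf hg hfn hgn => by
  rw [← transpose_submatrix, det_transpose]
  exact hX l g f hg hf hgn hfn

theorem MinorsPos.transpose {X : Matrix ℕ ℕ ℝ} {n k : ℕ} (hX : MinorsPos X n k) :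
    MinorsPos Xᵀ n k := fun f g hf hg hfn hgn => by
  rw [← transpose_submatrix, det_transpose]
  exact hX g f hg hf hgn hfn

theorem MinorsNonneg.apply_nonneg {X : Matrix ℕ ℕ ℝ} {n : ℕ} (hX : MinorsNonneg X n) {i j : ℕ}
    (hi : i < n) (hj : j < n) : 0 ≤ X i j := by
  have h := hX 1 ![i] ![j] (Subsingleton.strictMono _) (Subsingleton.strictMono _)
    (by simpa using hi) (by simpa using hj)
  rwa [det_fin_one] at h

theorem cons_zero_succ_val (k : ℕ) :
    (Fin.cons 0 (fun a : Fin k => (a : ℕ) + 1) : Fin (k + 1) → ℕ) = Fin.val := by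
  ext a
  refine Fin.cases ?_ (fun a => ?_) a <;> simp

theorem det_submatrix_val_succ (X : Matrix ℕ ℕ ℝ) (hX : X 0 0 ≠ 0) (k : ℕ) :
    (X.submatrix (Fin.val : Fin (k + 1) → ℕ) Fin.val).det
      = X 0 0 * ((schurStep X).submatrix (Fin.val : Fin k → ℕ) Fin.val).det := by
  rw [← det_submatrix_cons_zero X hX, cons_zero_succ_val]

/-- Schur complements preserve nonnegativity of all minors. -/
theorem MinorsNonneg.schurStep {X : Matrix ℕ ℕ ℝ} {n : ℕ} (hX : MinorsNonneg X (n + 1))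
    (h0 : 0 < X 0 0) : MinorsNonneg (schurStep X) n := by
  intro k f g hf hg hfn hgn
  have h := hX (k + 1) (Fin.cons 0 (fun a => f a + 1)) (Fin.cons 0 (fun a => g a + 1))
    (Fin.strictMono_cons.2 ⟨by simp, hf.add_const 1⟩)
    (Fin.strictMono_cons.2 ⟨by simp, hg.add_const 1⟩)
    (Fin.cases (by simp) (by simpa using hfn)) (Fin.cases (by simp) (by simpa using hgn))
  rw [det_submatrix_cons_zero X h0.ne'] at h
  exact nonneg_of_mul_nonneg_right h h0

theorem MinorsNonneg.apply_zero_zero_pos {X : Matrix ℕ ℕ ℝ} {n : ℕ}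
    (hX : MinorsNonneg X (n + 1))
    (hdet : (X.submatrix (Fin.val : Fin (n + 1) → ℕ) Fin.val).det ≠ 0) : 0 < X 0 0 := by
  refine lt_of_le_of_ne (hX.apply_nonneg (by simp) (by simp)) fun h0 => hdet ?_
  by_cases hrow : ∀ j : Fin (n + 1), X 0 j = 0
  · exact det_eq_zero_of_row_eq_zero 0 (by simpa using hrow)
  · push Not at hrow
    obtain ⟨j, hj⟩ := hrow
    refine det_eq_zero_of_column_eq_zero 0 fun i => ?_
    simp only [submatrix_apply, Fin.val_zero]
    have hj0 : 0 < (j : ℕ) := Nat.pos_of_ne_zero fun h => hj (by rw [h, ← h0])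
    rcases Nat.eq_zero_or_pos (i : ℕ) with hi | hi
    · rw [hi, ← h0]
    have h := hX 2 ![0, (i : ℕ)] ![0, (j : ℕ)] (by simpa using hi) (by simpa using hj0)
      (by simp [Fin.forall_fin_two]; omega) (by simp [Fin.forall_fin_two]; omega)
    simp only [det_fin_two, submatrix_apply, cons_val_zero, cons_val_one, ← h0, zero_mul,
      zero_sub] at h
    have h1 : 0 < X 0 j := lt_of_le_of_ne (hX.apply_nonneg (by simp) j.2) (Ne.symm hj)
    have h2 : 0 ≤ X i 0 := hX.apply_nonneg i.2 (by simp)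
    nlinarith

theorem MinorsNonneg.leading_pos {n : ℕ} : ∀ {X : Matrix ℕ ℕ ℝ}, MinorsNonneg X n →
    (X.submatrix (Fin.val : Fin n → ℕ) Fin.val).det ≠ 0 → ∀ {k : ℕ}, k ≤ n →
    0 < (X.submatrix (Fin.val : Fin k → ℕ) Fin.val).det := by
  induction n with
  | zero =>
    intro X _ _ k hk
    obtain rfl : k = 0 := by omega
    simp
  | succ n ih =>
    intro X hX hdet k hk
    have h0 := hX.apply_zero_zero_pos hdet
    cases k with
    | zero => simp
    | succ k =>
      rw [det_submatrix_val_succ X h0.ne'] at hdet ⊢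
      exact mul_pos h0 (ih (hX.schurStep h0) (right_ne_zero_of_mul hdet) (by omega))

/-- The reflection of the upper left `n × n` block of `X` in its antidiagonal. -/
def antiTranspose (X : Matrix ℕ ℕ ℝ) (n : ℕ) : Matrix ℕ ℕ ℝ :=
  Matrix.of fun i j => X (n - 1 - j) (n - 1 - i)

theorem det_antiTranspose_submatrix (X : Matrix ℕ ℕ ℝ) (n : ℕ) {k : ℕ} (f g : Fin k → ℕ) :
    ((antiTranspose X n).submatrix f g).det
      = (X.submatrix (fun a => n - 1 - g (Fin.rev a)) (fun a => n - 1 - f (Fin.rev a))).det := by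
  rw [← det_transpose, ← det_submatrix_equiv_self Fin.revPerm]
  rfl

theorem strictMono_sub_rev {n k : ℕ} {f : Fin k → ℕ} (hf : StrictMono f) (hfn : ∀ a, f a < n) :
    StrictMono fun a => n - 1 - f (Fin.rev a) := by
  intro a b hab
  have h1 := hf (Fin.rev_lt_rev.2 hab)
  have h2 := hfn a.rev
  dsimp only
  omega

theorem MinorsNonneg.antiTranspose {X : Matrix ℕ ℕ ℝ} {n : ℕ} (hX : MinorsNonneg X n) :
    MinorsNonneg (antiTranspose X n) n := fun k f g hf hg hfn hgn => by
  rw [det_antiTranspose_submatrix]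
  exact hX _ _ _ (strictMono_sub_rev hg hgn) (strictMono_sub_rev hf hfn)
    (fun a => by have := hgn a.rev; omega) (fun a => by have := hfn a.rev; omega)

theorem MinorsPos.antiTranspose {X : Matrix ℕ ℕ ℝ} {n k : ℕ} (hX : MinorsPos X n k) :
    MinorsPos (antiTranspose X n) n k := fun f g hf hg hfn hgn => by
  rw [det_antiTranspose_submatrix]
  exact hX _ _ (strictMono_sub_rev hg hgn) (strictMono_sub_rev hf hfn)
    (fun a => by have := hgn a.rev; omega) (fun a => by have := hfn a.rev; omega)

theorem det_antiTranspose_interval (X : Matrix ℕ ℕ ℝ) {n k i j : ℕ} (hi : i + k ≤ n)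
    (hj : j + k ≤ n) :
    ((antiTranspose X n).submatrix (fun a : Fin k => i + (a : ℕ))
      (fun a : Fin k => j + (a : ℕ))).det
      = (X.submatrix (fun a : Fin k => n - k - j + (a : ℕ))
        (fun a : Fin k => n - k - i + (a : ℕ))).det := by
  rw [det_antiTranspose_submatrix]
  congr 2 <;> ext a <;> simp only [Fin.val_rev] <;> omega

theorem det_antiTranspose_leading (X : Matrix ℕ ℕ ℝ) {n k : ℕ} (hk : k ≤ n) :
    ((antiTranspose X n).submatrix (Fin.val : Fin k → ℕ) Fin.val).det
      = (X.submatrix (fun a : Fin k => n - k + (a : ℕ))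
        (fun a : Fin k => n - k + (a : ℕ))).det := by
  simpa using det_antiTranspose_interval X (i := 0) (j := 0) (by omega : 0 + k ≤ n) (by omega)

/-- Principal minors on consecutive indices are positive. -/
theorem MinorsNonneg.principal_interval_pos {X : Matrix ℕ ℕ ℝ} {n : ℕ} (hX : MinorsNonneg X n)
    (hdet : (X.submatrix (Fin.val : Fin n → ℕ) Fin.val).det ≠ 0) {i k : ℕ} (hik : i + k ≤ n) :
    0 < (X.submatrix (fun a : Fin k => i + (a : ℕ)) (fun a : Fin k => i + (a : ℕ))).det := by
  have h := (hX.mono hik).antiTranspose.leading_pos (k := k)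
    (by simpa [det_antiTranspose_leading] using (hX.leading_pos hdet hik).ne') (by omega)
  rw [det_antiTranspose_leading X (by omega)] at h
  simpa using h

theorem strictMono_const_add_val (i k : ℕ) : StrictMono fun a : Fin k => i + (a : ℕ) :=
  fun _ _ h => Nat.add_lt_add_left h i

/-- Above the diagonal, a vanishing minor of consecutive rows and columns stays zero when moved
one row up. -/
theorem interval_minor_eq_zero_of_succ_row {X : Matrix ℕ ℕ ℝ} {n m : ℕ} (hX : MinorsNonneg X n)
    (hdet : (X.submatrix (Fin.val : Fin n → ℕ) Fin.val).det ≠ 0) (hpos : MinorsPos X n m)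
    {i j : ℕ} (hij : i + 1 < j) (hj : j + (m + 1) ≤ n)
    (h0 : (X.submatrix (fun a : Fin (m + 1) => i + 1 + (a : ℕ))
        (fun a : Fin (m + 1) => j + (a : ℕ))).det = 0) :
    (X.submatrix (fun a : Fin (m + 1) => i + (a : ℕ))
      (fun a : Fin (m + 1) => j + (a : ℕ))).det = 0 := by
  by_contra hne
  have hleft : ∀ c < j, (X.submatrix (fun a : Fin (m + 1) => i + 1 + (a : ℕ))
      (Fin.cons c (fun a : Fin m => j + (a : ℕ)) : Fin (m + 1) → ℕ)).det = 0 := by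
    intro c hc
    by_contra hSW
    have hcons : ∀ l, StrictMono (Fin.cons c (fun a : Fin l => j + (a : ℕ)) : Fin (l + 1) → ℕ) :=
      fun l => Fin.strictMono_cons.2 ⟨fun a => by omega, strictMono_const_add_val j l⟩
    have hcn : ∀ l ≤ m + 1, ∀ a,
        (Fin.cons c (fun a : Fin l => j + (a : ℕ)) : Fin (l + 1) → ℕ) a < n :=
      fun l hl => Fin.cases (by simp; omega) (fun a => by simp; omega)
    have hcols : (Fin.cons c (fun a : Fin (m + 1) => j + (a : ℕ)) : Fin (m + 2) → ℕ) ∘ Fin.castSucc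
        = Fin.cons c (fun a : Fin m => j + (a : ℕ)) := by
      ext a
      refine Fin.cases ?_ (fun a => ?_) a <;> simp
    have hrows : (fun a : Fin (m + 2) => i + (a : ℕ)) ∘ Fin.succ
        = fun a : Fin (m + 1) => i + 1 + (a : ℕ) := by
      ext a; simp; omega
    have key := det_castSucc_succ_eq_zero
      (X.submatrix (fun a : Fin (m + 2) => i + (a : ℕ))
        (Fin.cons c (fun a : Fin (m + 1) => j + (a : ℕ)) : Fin (m + 2) → ℕ))
      (hX _ _ _ (strictMono_const_add_val i _) (hcons _) (fun a => by omega) (hcn _ le_rfl))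
      (fun q => hpos _ _
        ((strictMono_const_add_val i _).comp (Fin.strictMono_succ.comp Fin.strictMono_castSucc))
        ((hcons _).comp (Fin.strictMono_succ.comp (Fin.strictMono_succAbove q)))
        (fun a => by dsimp; omega) (fun a => hcn _ le_rfl _))
      (by rw [submatrix_submatrix, hrows]; exact h0)
      (hX _ _ _ ((strictMono_const_add_val i _).comp Fin.strictMono_castSucc)
        ((hcons _).comp Fin.strictMono_succ) (fun a => by dsimp; omega) (fun a => hcn _ le_rfl _))
      (by
        rw [submatrix_submatrix, hrows, hcols]
        exact lt_of_le_of_ne (hX _ _ _ (strictMono_const_add_val _ _) (hcons _)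
          (fun a => by omega) (hcn _ (by omega))) (Ne.symm hSW))
    exact hne key
  have hall : ∀ c < j + m, (X.submatrix (fun a : Fin (m + 1) => i + 1 + (a : ℕ))
      (Fin.cons c (fun a : Fin m => j + (a : ℕ)) : Fin (m + 1) → ℕ)).det = 0 := by
    intro c hc
    rcases lt_or_ge c j with h | h
    · exact hleft c h
    · refine det_zero_of_column_eq (i := 0) (j := Fin.succ ⟨c - j, by omega⟩)
        (Fin.succ_ne_zero _).symm fun a => ?_
      simp only [submatrix_apply, Fin.cons_zero, Fin.cons_succ, Nat.add_sub_cancel' h]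
  set lam : Fin (m + 1) → ℝ := fun a => (-1) ^ (a : ℕ) *
    (X.submatrix (fun b => i + 1 + (a.succAbove b : ℕ))
      (fun b : Fin m => j + (b : ℕ))).det with hlam
  have hker : lam ᵥ* X.submatrix (fun a : Fin (m + 1) => i + 1 + (a : ℕ))
      (fun a : Fin (m + 1) => i + 1 + (a : ℕ)) = 0 := by
    ext b
    have h := hall (i + 1 + b) (by omega)
    rw [det_succ_column_zero] at h
    rw [Pi.zero_apply, ← h, vecMul, dotProduct]
    refine Finset.sum_congr rfl fun a _ => ?_
    simp only [hlam, submatrix_apply, Fin.cons_zero]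
    rw [mul_right_comm]
    rfl
  have hlam0 := congrFun (eq_zero_of_vecMul_eq_zero
    (hX.principal_interval_pos hdet (by omega)).ne' hker) 0
  have := hpos (fun b => i + 1 + ((0 : Fin (m + 1)).succAbove b : ℕ)) (fun b : Fin m => j + (b : ℕ))
    ((strictMono_const_add_val _ _).comp (Fin.strictMono_succAbove 0))
    (strictMono_const_add_val _ _) (fun a => by omega) (fun a => by omega)
  simp only [hlam, Fin.val_zero, pow_zero, one_mul, Pi.zero_apply] at hlam0
  exact this.ne' hlam0

/-- Above the diagonal, a vanishing minor of consecutive rows and columns stays zero when moved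
one column to the right. -/
theorem interval_minor_succ_col_eq_zero {X : Matrix ℕ ℕ ℝ} {n m : ℕ} (hX : MinorsNonneg X n)
    (hdet : (X.submatrix (Fin.val : Fin n → ℕ) Fin.val).det ≠ 0) (hpos : MinorsPos X n m)
    {i j : ℕ} (hij : i < j) (hj : j + 1 + (m + 1) ≤ n)
    (h0 : (X.submatrix (fun a : Fin (m + 1) => i + (a : ℕ))
        (fun a : Fin (m + 1) => j + (a : ℕ))).det = 0) :
    (X.submatrix (fun a : Fin (m + 1) => i + (a : ℕ))
      (fun a : Fin (m + 1) => j + 1 + (a : ℕ))).det = 0 := by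
  have key := interval_minor_eq_zero_of_succ_row hX.antiTranspose
    (by simpa [det_antiTranspose_leading] using hdet) hpos.antiTranspose
    (i := n - (m + 1) - (j + 1)) (j := n - (m + 1) - i) (by omega) (by omega)
  rw [det_antiTranspose_interval X (by omega) (by omega),
    det_antiTranspose_interval X (by omega) (by omega)] at key
  rw [show n - (m + 1) - (n - (m + 1) - i) = i by omega,
    show n - (m + 1) - (n - (m + 1) - (j + 1) + 1) = j by omega,
    show n - (m + 1) - (n - (m + 1) - (j + 1)) = j + 1 by omega] at key
  exact key h0

theorem interval_minor_pos_of_lt {X : Matrix ℕ ℕ ℝ} {n m : ℕ} (hX : MinorsNonneg X n)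
    (hdet : (X.submatrix (Fin.val : Fin n → ℕ) Fin.val).det ≠ 0) (hpos : MinorsPos X n m)
    (hcorner : m + 1 ≤ n → (X.submatrix (Fin.val : Fin (m + 1) → ℕ)
      (fun a : Fin (m + 1) => n - (m + 1) + (a : ℕ))).det ≠ 0)
    {i j : ℕ} (hij : i < j) (hj : j + (m + 1) ≤ n) :
    0 < (X.submatrix (fun a : Fin (m + 1) => i + (a : ℕ))
      (fun a : Fin (m + 1) => j + (a : ℕ))).det := by
  refine lt_of_le_of_ne (hX _ _ _ (strictMono_const_add_val _ _) (strictMono_const_add_val _ _)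
    (fun a => by omega) (fun a => by omega)) fun h0 => hcorner (by omega) ?_
  have hup : ∀ i < j, (X.submatrix (fun a : Fin (m + 1) => i + (a : ℕ))
      (fun a : Fin (m + 1) => j + (a : ℕ))).det = 0 →
      (X.submatrix (fun a : Fin (m + 1) => 0 + (a : ℕ))
        (fun a : Fin (m + 1) => j + (a : ℕ))).det = 0 := by
    intro i
    induction i with
    | zero => exact fun _ h => h
    | succ i ih =>
      exact fun hi h => ih (by omega) (interval_minor_eq_zero_of_succ_row hX hdet hpos hi hj h)
  have hright : ∀ d, j + d + (m + 1) ≤ n → (X.submatrix (fun a : Fin (m + 1) => 0 + (a : ℕ))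
      (fun a : Fin (m + 1) => j + d + (a : ℕ))).det = 0 := by
    intro d
    induction d with
    | zero => exact fun _ => hup i hij h0.symm
    | succ d ih =>
      intro hd
      exact interval_minor_succ_col_eq_zero (i := 0) (j := j + d) hX hdet hpos (by omega)
        (by omega) (ih (by omega))
  have := hright (n - (m + 1) - j) (by omega)
  rw [show j + (n - (m + 1) - j) = n - (m + 1) by omega] at this
  simpa using this

/-- A row version of Fekete's criterion. -/
theorem minor_pos_of_interval_rows {X : Matrix ℕ ℕ ℝ} {n m : ℕ} (hX : MinorsNonneg X n)
    (hpos : MinorsPos X n m) {g : Fin (m + 1) → ℕ} (hg : StrictMono g) (hgn : ∀ a, g a < n)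
    (hint : ∀ i, i + (m + 1) ≤ n →
      0 < (X.submatrix (fun a : Fin (m + 1) => i + (a : ℕ)) g).det) :
    ∀ (d : ℕ) (f : Fin (m + 1) → ℕ), StrictMono f → (∀ a, f a < n) → f (Fin.last m) - f 0 = d →
      0 < (X.submatrix f g).det := by
  intro d
  induction d using Nat.strong_induction_on with
  | _ d ih =>
  intro f hf hfn hd
  by_cases hgap : ∃ p : Fin m, f p.castSucc + 1 < f p.succ
  · obtain ⟨p, hp⟩ := hgap
    set h : Fin (m + 2) → ℕ :=
      Fin.insertNth p.castSucc.succ (α := fun _ => ℕ) (f p.castSucc + 1) f with hh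
    have hmono : StrictMono h := Fin.strictMono_insertNth hf p _ (by omega) hp
    have hhn : ∀ a, h a < n := by
      intro a
      refine Fin.succAboveCases p.castSucc.succ ?_ (fun b => ?_) a
      · have := hfn p.succ
        simp only [hh, Fin.insertNth_apply_same]; omega
      · simpa [hh] using hfn b
    have hcomp : h ∘ p.castSucc.succ.succAbove = f := by ext a; simp [hh]
    have hp0 : p.castSucc.succ ≠ 0 := Fin.succ_ne_zero _
    have hpl : p.castSucc.succ ≠ Fin.last _ := by
      rw [Fin.succ_castSucc]; exact (Fin.castSucc_lt_last _).ne
    have hfirst : h 0 = f 0 := by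
      rw [← hcomp, Function.comp_apply, Fin.succAbove_ne_zero_zero hp0]
    have hlast : h (Fin.last _) = f (Fin.last m) := by
      rw [← hcomp, Function.comp_apply, Fin.succAbove_ne_last_last hpl]
    refine lt_of_le_of_ne (hX _ _ _ hf hg hfn hgn) fun h0 => ?_
    have key := det_succ_eq_zero_of_interior (Matrix.transpose (X.submatrix h g))
      p.castSucc.succ hp0 hpl
      (fun q => hpos.transpose _ _ (hg.comp Fin.strictMono_succ)
        (hmono.comp ((Fin.strictMono_succAbove _).comp (Fin.strictMono_succAbove _)))
        (fun _ => hgn _) (fun _ => hhn _))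
      (fun q => hX.transpose _ _ _ hg (hmono.comp (Fin.strictMono_succAbove _)) hgn
        (fun _ => hhn _))
      (by
        rw [← transpose_submatrix, det_transpose, submatrix_submatrix, hcomp]
        exact h0.symm)
    rw [← transpose_submatrix, det_transpose, submatrix_submatrix] at key
    have h1 : h 0 < h (Fin.succ 0) := hmono (Fin.succ_pos 0)
    have h2 : h (Fin.succ 0) ≤ h (Fin.last _) := hmono.monotone (Fin.le_last _)
    refine (ih (f (Fin.last m) - h (Fin.succ 0)) (by omega) (h ∘ Fin.succAbove 0)
      (hmono.comp (Fin.strictMono_succAbove _)) (fun _ => hhn _) ?_).ne' key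
    simp [← hlast]
  · push Not at hgap
    have hf0 : ∀ a : Fin (m + 1), f a = f 0 + a := by
      intro a
      induction a using Fin.induction with
      | zero => simp
      | succ a ih =>
        have h1 := hgap a
        have h2 := hf a.castSucc_lt_succ
        simp only [Fin.val_castSucc, Fin.val_succ] at *
        omega
    rw [show f = fun a : Fin (m + 1) => f 0 + (a : ℕ) from funext hf0]
    refine hint _ ?_
    have := hfn (Fin.last m)
    rw [hf0] at this
    simp at this
    omega

/-- A nonsingular matrix with nonnegative minors and nonvanishing upper right and lower left
corner minors has positive minors. -/
theorem MinorsNonneg.minorsPos {X : Matrix ℕ ℕ ℝ} {n : ℕ} (hX : MinorsNonneg X n)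
    (hdet : (X.submatrix (Fin.val : Fin n → ℕ) Fin.val).det ≠ 0)
    (hUR : ∀ k ≤ n, (X.submatrix (Fin.val : Fin k → ℕ) (fun a : Fin k => n - k + (a : ℕ))).det ≠ 0)
    (hLL : ∀ k ≤ n, (Xᵀ.submatrix (Fin.val : Fin k → ℕ) (fun a : Fin k => n - k + (a : ℕ))).det ≠ 0)
    (k : ℕ) : MinorsPos X n k := by
  induction k with
  | zero => intro f g _ _ _ _; simp
  | succ m hpos =>
    have hint : ∀ i j, i + (m + 1) ≤ n → j + (m + 1) ≤ n →
        0 < (X.submatrix (fun a : Fin (m + 1) => i + (a : ℕ))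
          (fun a : Fin (m + 1) => j + (a : ℕ))).det := by
      intro i j hi hj
      rcases lt_trichotomy i j with h | rfl | h
      · exact interval_minor_pos_of_lt hX hdet hpos (hUR _) h hj
      · exact hX.principal_interval_pos hdet hi
      · have := interval_minor_pos_of_lt hX.transpose
          (by rwa [← transpose_submatrix, det_transpose]) hpos.transpose (hLL _) h hi
        rwa [← transpose_submatrix, det_transpose] at this
    intro f g hf hg hfn hgn
    refine minor_pos_of_interval_rows hX hpos hg hgn (fun i hi => ?_) _ f hf hfn rfl
    have := minor_pos_of_interval_rows hX.transpose hpos.transpose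
      (strictMono_const_add_val i (m + 1)) (fun a => by omega)
      (fun j hj => by
        rw [← transpose_submatrix, det_transpose]
        exact hint i j hi hj) _ g hg hgn rfl
    rwa [← transpose_submatrix, det_transpose] at this

/-- The extension of a matrix by zero to all natural number indices. -/
noncomputable def natExtend {n : ℕ} (x : Matrix (Fin n) (Fin n) ℝ) : Matrix ℕ ℕ ℝ :=
  Matrix.of fun i j => if h : i < n ∧ j < n then x ⟨i, h.1⟩ ⟨j, h.2⟩ else 0

theorem natExtend_submatrix {n k : ℕ} (x : Matrix (Fin n) (Fin n) ℝ) {f g : Fin k → ℕ}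
    (hf : ∀ a, f a < n) (hg : ∀ a, g a < n) :
    (natExtend x).submatrix f g = x.submatrix (fun a => ⟨f a, hf a⟩) (fun a => ⟨g a, hg a⟩) := by
  ext a b
  simp [natExtend, hf, hg]

theorem natExtend_submatrix_val {n : ℕ} (x : Matrix (Fin n) (Fin n) ℝ) :
    (natExtend x).submatrix Fin.val Fin.val = x :=
  natExtend_submatrix x Fin.isLt Fin.isLt

theorem natExtend_transpose {n : ℕ} (x : Matrix (Fin n) (Fin n) ℝ) :
    natExtend xᵀ = (natExtend x)ᵀ := by
  ext i j
  simp [natExtend, and_comm]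

theorem TotallyNonneg.minorsNonneg {n : ℕ} {x : Matrix (Fin n) (Fin n) ℝ}
    (hx : TotallyNonneg x) : MinorsNonneg (natExtend x) n := fun k f g hf hg hfn hgn => by
  rw [natExtend_submatrix x hfn hgn]
  exact hx k _ _ hf hg

theorem totallyPos_of_minorsPos {n : ℕ} {x : Matrix (Fin n) (Fin n) ℝ}
    (hx : ∀ k, MinorsPos (natExtend x) n k) : TotallyPos x := fun k f g hf hg => by
  have h := hx k (Fin.val ∘ f) (Fin.val ∘ g) hf hg (fun a => (f a).2) (fun a => (g a).2)
  rwa [← submatrix_submatrix, natExtend_submatrix_val] at h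

theorem TotallyPos.transpose {n : ℕ} {x : Matrix (Fin n) (Fin n) ℝ} (hx : TotallyPos x) :
    TotallyPos xᵀ := fun k f g hf hg => by
  rw [← transpose_submatrix, det_transpose]
  exact hx k g f hg hf

theorem mul_antidiagPerm {n : ℕ} (A : Matrix (Fin n) (Fin n) ℝ) :
    A * antidiagPerm n = A.submatrix id Fin.rev := by
  ext i j
  rw [mul_apply, Finset.sum_eq_single j.rev]
  · have : (j.rev : ℕ) + j = n - 1 := by rw [Fin.val_rev]; omega
    simp only [antidiagPerm, of_apply, if_pos this, mul_one, submatrix_apply, id]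
  · intro b _ hb
    have : (b : ℕ) + j ≠ n - 1 := fun h => hb (by ext; rw [Fin.val_rev]; omega)
    simp [antidiagPerm, this]
  · simp

theorem antidiagPerm_transpose (n : ℕ) : (antidiagPerm n)ᵀ = antidiagPerm n := by
  ext i j
  simp [antidiagPerm, add_comm]

theorem Matrix.IsLowerTriangular.apply_self_ne_zero {n : ℕ} {c : Matrix (Fin n) (Fin n) ℝ}
    (hc : c.IsLowerTriangular) (hu : IsUnit c) (i : Fin n) : c i i ≠ 0 := by
  have h := ((isUnit_iff_isUnit_det c).1 hu).ne_zero
  rw [det_of_isLowerTriangular c hc, Finset.prod_ne_zero_iff] at h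
  exact h i (Finset.mem_univ i)

theorem Matrix.IsLowerTriangular.det_submatrix_ne_zero {n k : ℕ} {c : Matrix (Fin n) (Fin n) ℝ}
    (hc : c.IsLowerTriangular) (hu : IsUnit c) {f : Fin k → Fin n} (hf : StrictMono f) :
    (c.submatrix f f).det ≠ 0 := by
  rw [det_of_isLowerTriangular (c.submatrix f f) (fun i j h => hc (hf h)), Finset.prod_ne_zero_iff]
  exact fun i _ => hc.apply_self_ne_zero hu _

theorem upper_right_minor_ne_zero {n : ℕ} {x c₁ c₂ : Matrix (Fin n) (Fin n) ℝ}
    (hu₁ : IsUnit c₁) (hu₂ : IsUnit c₂) (h₁ : c₁.IsLowerTriangular) (h₂ : c₂.IsLowerTriangular)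
    (hx : x = c₁ * antidiagPerm n * c₂) {k : ℕ} (hk : k ≤ n) :
    ((natExtend x).submatrix (Fin.val : Fin k → ℕ) (fun a : Fin k => n - k + (a : ℕ))).det ≠ 0 := by
  obtain ⟨t, rfl⟩ := Nat.exists_eq_add_of_le hk
  set e : Fin k → Fin (k + t) := fun a => ⟨k + t - k + (a : ℕ), by omega⟩ with he
  have hmono : StrictMono e := fun a b h => by
    simp only [he, Fin.mk_lt_mk]; omega
  have hprod : (natExtend x).submatrix (Fin.val : Fin k → ℕ)
      (fun a : Fin k => k + t - k + (a : ℕ))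
      = c₁.submatrix (Fin.castAdd t) (Fin.castAdd t) *
        (c₂.submatrix e e).submatrix Fin.revPerm id := by
    rw [natExtend_submatrix x (fun a => by omega) (fun a => by omega)]
    ext a b
    rw [submatrix_apply, hx, mul_antidiagPerm, mul_apply, mul_apply,
      ← Equiv.sum_comp Fin.revPerm, Fin.sum_univ_add]
    have hz : ∀ i : Fin t, c₁ ⟨(a : ℕ), by omega⟩ (Fin.natAdd k i) = 0 := fun i =>
      h₁ (by simp [Fin.lt_def]; omega)
    simp only [submatrix_apply, Fin.revPerm_apply, Fin.rev_rev, id, hz, zero_mul,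
      Finset.sum_const_zero, add_zero]
    refine Finset.sum_congr rfl fun i _ => ?_
    congr 2
    ext
    simp [he, Fin.val_rev]
    omega
  rw [hprod, det_mul, det_permute]
  exact mul_ne_zero (h₁.det_submatrix_ne_zero hu₁ (Fin.strictMono_castAdd t))
    (mul_ne_zero (by simp) (h₂.det_submatrix_ne_zero hu₂ hmono))

/-- A matrix with nonvanishing leading principal minors has an LU factorization. -/
theorem exists_lower_mul_upper {n : ℕ} : ∀ {Y : Matrix ℕ ℕ ℝ},
    (∀ k ≤ n, (Y.submatrix (Fin.val : Fin k → ℕ) Fin.val).det ≠ 0) →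
    ∃ L U : Matrix (Fin n) (Fin n) ℝ, L.IsLowerTriangular ∧ U.IsUpperTriangular ∧
      Y.submatrix Fin.val Fin.val = L * U := by
  induction n with
  | zero =>
    exact fun _ => ⟨1, 1, fun i => i.elim0, fun i => i.elim0, by ext i; exact i.elim0⟩
  | succ n ih =>
    intro Y hY
    have h0 : Y 0 0 ≠ 0 := by
      have := hY 1 (by omega)
      rwa [det_fin_one] at this
    obtain ⟨L, U, hL, hU, hLU⟩ := ih (Y := schurStep Y) fun k hk => by
      have := hY (k + 1) (by omega)
      rw [det_submatrix_val_succ Y h0] at this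
      exact right_ne_zero_of_mul this
    refine ⟨Matrix.of (Fin.cons (Fin.cons 1 0) fun i => Fin.cons (Y (i + 1) 0 / Y 0 0) (L i)),
      Matrix.of (Fin.cons (fun j => Y 0 j) fun i => Fin.cons 0 (U i)), ?_, ?_, ?_⟩
    · intro i j hij
      have hij' : i < j := hij
      cases i using Fin.cases <;> cases j using Fin.cases
      · simp at hij'
      · simp
      · simp at hij'
      · simpa using hL (by simpa using hij')
    · intro i j hij
      cases i using Fin.cases <;> cases j using Fin.cases
      · simp at hij
      · simp at hij
      · simp
      · simpa using hU (by simpa using hij)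
    · ext i j
      rw [mul_apply, Fin.sum_univ_succ]
      cases i using Fin.cases with
      | zero => simp
      | succ i =>
        cases j using Fin.cases with
        | zero => simp [h0]
        | succ j =>
          have h := congrFun (congrFun hLU i) j
          rw [mul_apply] at h
          simp only [of_apply, Fin.cons_succ, Fin.cons_zero, submatrix_apply, Fin.val_succ, ← h]
          simp [schurStep]

theorem TotallyPos.exists_upper_mul_antidiagPerm_mul_upper {n : ℕ}
    {x : Matrix (Fin n) (Fin n) ℝ} (hx : TotallyPos x) :
    ∃ b₁ b₂ : Matrix (Fin n) (Fin n) ℝ, IsUnit b₁ ∧ IsUnit b₂ ∧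
      b₁.IsUpperTriangular ∧ b₂.IsUpperTriangular ∧ x = b₁ * antidiagPerm n * b₂ := by
  obtain ⟨L, U, hL, hU, hLU⟩ := exists_lower_mul_upper (n := n)
    (Y := natExtend (x.submatrix Fin.rev id)) fun k hk => by
      have h := hx k (Fin.rev ∘ Fin.castLE hk ∘ Fin.rev) (Fin.castLE hk)
        (fun a b h => Fin.rev_lt_rev.2 (Fin.strictMono_castLE hk (Fin.rev_lt_rev.2 h)))
        (Fin.strictMono_castLE hk)
      have heq : (natExtend (x.submatrix Fin.rev id)).submatrix (Fin.val : Fin k → ℕ) Fin.val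
          = (x.submatrix (Fin.rev ∘ Fin.castLE hk ∘ Fin.rev) (Fin.castLE hk)).submatrix
            Fin.revPerm id := by
        rw [natExtend_submatrix _ (fun a => by omega) (fun a => by omega)]
        ext a b
        simp [Fin.castLE]
      rw [heq, det_permute]
      exact mul_ne_zero (by simp) h.ne'
  rw [natExtend_submatrix_val] at hLU
  have hfac : x = L.submatrix Fin.rev Fin.rev * antidiagPerm n * U := by
    rw [mul_antidiagPerm]
    ext i j
    have h := congrFun (congrFun hLU i.rev) j
    rw [mul_apply] at h ⊢
    simpa using h
  have hdet : x.det ≠ 0 := by simpa using (hx n id id strictMono_id strictMono_id).ne'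
  have hdet' := hdet
  rw [hfac, det_mul, det_mul] at hdet'
  refine ⟨_, U, (isUnit_iff_isUnit_det _).2 ?_, (isUnit_iff_isUnit_det _).2 ?_, ?_, hU, hfac⟩
  · exact (left_ne_zero_of_mul (left_ne_zero_of_mul hdet')).isUnit
  · exact (right_ne_zero_of_mul hdet').isUnit
  · exact fun i j hij => hL (Fin.rev_lt_rev.2 hij)

/-- An invertible totally nonnegative matrix is totally positive iff it lies in the
intersection of opposite open Bruhat cells `B w₀ B ∩ B₋ w₀ B₋`. -/
theorem stmt3 (n : ℕ) (hn : 1 ≤ n) (x : Matrix (Fin n) (Fin n) ℝ)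
    (hx : IsUnit x) (htnn : TotallyNonneg x) :
    TotallyPos x ↔
      ((∃ b₁ b₂ : Matrix (Fin n) (Fin n) ℝ, IsUnit b₁ ∧ IsUnit b₂ ∧
          (∀ i j : Fin n, j < i → b₁ i j = 0) ∧ (∀ i j : Fin n, j < i → b₂ i j = 0) ∧
          x = b₁ * antidiagPerm n * b₂) ∧
       (∃ c₁ c₂ : Matrix (Fin n) (Fin n) ℝ, IsUnit c₁ ∧ IsUnit c₂ ∧
          (∀ i j : Fin n, i < j → c₁ i j = 0) ∧ (∀ i j : Fin n, i < j → c₂ i j = 0) ∧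
          x = c₁ * antidiagPerm n * c₂)) := by
  constructor
  · intro h
    obtain ⟨b₁, b₂, hu₁, hu₂, h₁, h₂, hb⟩ := h.exists_upper_mul_antidiagPerm_mul_upper
    obtain ⟨d₁, d₂, hv₁, hv₂, g₁, g₂, hd⟩ := h.transpose.exists_upper_mul_antidiagPerm_mul_upper
    refine ⟨⟨b₁, b₂, hu₁, hu₂, fun i j hij => h₁ hij, fun i j hij => h₂ hij, hb⟩,
      ⟨d₂ᵀ, d₁ᵀ, (isUnit_transpose d₂).2 hv₂, (isUnit_transpose d₁).2 hv₁,
        fun i j hij => g₂ hij, fun i j hij => g₁ hij, ?_⟩⟩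
    rw [← transpose_transpose x, hd]
    simp [transpose_mul, antidiagPerm_transpose, Matrix.mul_assoc]
  · rintro ⟨⟨b₁, b₂, hu₁, hu₂, h₁, h₂, hb⟩, c₁, c₂, hv₁, hv₂, g₁, g₂, hc⟩
    refine totallyPos_of_minorsPos (htnn.minorsNonneg.minorsPos ?_ ?_ ?_)
    · rw [natExtend_submatrix_val]
      exact ((isUnit_iff_isUnit_det x).1 hx).ne_zero
    · exact fun k hk => upper_right_minor_ne_zero hv₁ hv₂ (fun i j hij => g₁ i j hij)
        (fun i j hij => g₂ i j hij) hc hk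
    · intro k hk
      rw [← natExtend_transpose]
      refine upper_right_minor_ne_zero (c₁ := b₂ᵀ) (c₂ := b₁ᵀ) ((isUnit_transpose b₂).2 hu₂)
        ((isUnit_transpose b₁).2 hu₁) (fun i j hij => h₂ j i hij) (fun i j hij => h₁ j i hij) ?_ hk
      rw [hb]
      simp [transpose_mul, antidiagPerm_transpose, Matrix.mul_assoc]
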